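/- arXiv:1711.07087 — 2 statements merged into one kernel-verified Lean document; each statement's English description precedes it below -/
import Mathlib

section
/- The Ricci curvature of the Levi-Civita connection of the pp-metric, {Ric}_{λν} := R[{Γ}]^μ_{λμν}, equals ½ (∂₁²f + ∂₂²f) l_λ l_ν; that is, its only nonzero component is {Ric}₃₃ = ½ (∂₁²f + ∂₂²f). -/
noncomputable section

open scoped BigOperators

/-- Points of spacetime: ℝ⁴ with coordinates x⁰, x¹, x², x³. -/
abbrev Spacetime := Fin 4 → ℝ

/-- Partial derivative ∂_μ of a scalar function. -/
def pd (μ : Fin 4) (h : Spacetime → ℝ) : Spacetime → ℝ :=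
  fun x => fderiv ℝ h x (Pi.single μ 1)

/-- The pp-metric g_{μν}: nonzero components g₀₃ = g₃₀ = 1, g₁₁ = g₂₂ = −1, g₃₃ = f. -/
def ppMetric (f : Spacetime → ℝ) (x : Spacetime) (μ ν : Fin 4) : ℝ :=
  if μ = 0 ∧ ν = 3 then 1 else if μ = 3 ∧ ν = 0 then 1
  else if μ = 1 ∧ ν = 1 then -1 else if μ = 2 ∧ ν = 2 then -1
  else if μ = 3 ∧ ν = 3 then f x else 0

/-- The pointwise inverse metric g^{μν}: g⁰⁰ = −f, g⁰³ = g³⁰ = 1, g¹¹ = g²² = −1. -/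
def ppMetricInv (f : Spacetime → ℝ) (x : Spacetime) (μ ν : Fin 4) : ℝ :=
  if μ = 0 ∧ ν = 0 then -(f x) else if μ = 0 ∧ ν = 3 then 1
  else if μ = 3 ∧ ν = 0 then 1
  else if μ = 1 ∧ ν = 1 then -1 else if μ = 2 ∧ ν = 2 then -1 else 0

/-- Christoffel symbols {Γ}^λ_{μν} = ½ g^{λκ}(∂_μ g_{κν} + ∂_ν g_{κμ} − ∂_κ g_{μν}). -/
def christoffel (f : Spacetime → ℝ) (x : Spacetime) (l μ ν : Fin 4) : ℝ :=
  (1/2) * ∑ κ, ppMetricInv f x l κ *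
    (pd μ (fun y => ppMetric f y κ ν) x + pd ν (fun y => ppMetric f y κ μ) x
      - pd κ (fun y => ppMetric f y μ ν) x)

/-- Totally antisymmetric symbol ε with ε₀₁₂₃ = 1. -/
def eps (a b c d : Fin 4) : ℝ :=
  ((((b:ℕ):ℝ) - ((a:ℕ):ℝ)) * (((c:ℕ):ℝ) - ((a:ℕ):ℝ)) * (((d:ℕ):ℝ) - ((a:ℕ):ℝ)) *
    (((c:ℕ):ℝ) - ((b:ℕ):ℝ)) * (((d:ℕ):ℝ) - ((b:ℕ):ℝ)) * (((d:ℕ):ℝ) - ((c:ℕ):ℝ))) / 12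

/-- Purely axial torsion T_{κμν} = k(x³) ε_{0κμν}. -/
def torsion (k : ℝ → ℝ) (x : Spacetime) (κ μ ν : Fin 4) : ℝ :=
  k (x 3) * eps 0 κ μ ν

/-- Contorsion K^κ_{μν} = ½ g^{κρ} T_{ρμν}. -/
def contorsion (f : Spacetime → ℝ) (k : ℝ → ℝ) (x : Spacetime) (κ μ ν : Fin 4) : ℝ :=
  (1/2) * ∑ ρ, ppMetricInv f x κ ρ * torsion k x ρ μ ν

/-- The full connection Γ^λ_{μν} = {Γ}^λ_{μν} + K^λ_{μν}. -/
def fullConn (f : Spacetime → ℝ) (k : ℝ → ℝ) (x : Spacetime) (κ μ ν : Fin 4) : ℝ :=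
  christoffel f x κ μ ν + contorsion f k x κ μ ν

/-- Curvature R[A]^κ_{λμν} of connection coefficients A^κ_{μν}. -/
def curv (A : Spacetime → Fin 4 → Fin 4 → Fin 4 → ℝ) (x : Spacetime)
    (κ l μ ν : Fin 4) : ℝ :=
  pd μ (fun y => A y κ ν l) x - pd ν (fun y => A y κ μ l) x
    + ∑ η, (A x κ μ η * A x η ν l - A x κ ν η * A x η μ l)

/-- The parallel null vector field l^μ = (1,0,0,0). -/
def lUp : Fin 4 → ℝ := fun μ => if μ = 0 then 1 else 0

/-- The lowered vector l_μ = g_{μν} l^ν = (0,0,0,1). -/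
def lCov : Fin 4 → ℝ := fun μ => if μ = 3 then 1 else 0

/-- Ricci curvature of the Levi-Civita connection: {Ric}_{λν} = R[{Γ}]^μ_{λμν}. -/
def RicLC (f : Spacetime → ℝ) (x : Spacetime) (lam ν : Fin 4) : ℝ :=
  ∑ μ, curv (christoffel f) x μ lam μ ν

/-- Each metric component is constant except `g₃₃ = f`. -/
theorem pd_ppMetric (f : Spacetime → ℝ) (x : Spacetime) (κ μ ν : Fin 4) :
    pd κ (fun y => ppMetric f y μ ν) x = lCov μ * lCov ν * pd κ f x := by
  fin_cases μ <;> fin_cases ν <;> simp [ppMetric, pd, lCov]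

theorem christoffel_eq {f : Spacetime → ℝ} (h0 : ∀ x, pd 0 f x = 0) (x : Spacetime)
    (l μ ν : Fin 4) :
    christoffel f x l μ ν =
      (1/2 * lUp l * lCov ν) * pd μ f x + (1/2 * lUp l * lCov μ) * pd ν f x
        - (1/2 * lUp l * lCov μ * lCov ν) * pd 3 f x
        + (1/2 * (if l = 1 then 1 else 0) * lCov μ * lCov ν) * pd 1 f x
        + (1/2 * (if l = 2 then 1 else 0) * lCov μ * lCov ν) * pd 2 f x := by
  simp only [christoffel, pd_ppMetric, Fin.sum_univ_four]
  fin_cases l <;> simp [ppMetricInv, lUp, show lCov 0 = 0 from rfl, show lCov 1 = 0 from rfl,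
    show lCov 2 = 0 from rfl, show lCov 3 = 1 from if_pos rfl, h0] <;> ring

theorem differentiable_fderiv_of_smooth {f : Spacetime → ℝ} (hf : ContDiff ℝ (⊤ : ℕ∞) f) :
    Differentiable ℝ (fderiv ℝ f) :=
  (hf.fderiv_right (m := (⊤ : ℕ∞)) le_rfl).differentiable (by simp)

theorem differentiable_pd {f : Spacetime → ℝ} (hf : ContDiff ℝ (⊤ : ℕ∞) f) (μ : Fin 4) :
    Differentiable ℝ (pd μ f) :=
  (differentiable_fderiv_of_smooth hf).clm_apply (differentiable_const _)

theorem pd_pd {f : Spacetime → ℝ} (hf : ContDiff ℝ (⊤ : ℕ∞) f) (μ ν : Fin 4) (x : Spacetime) :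
    pd μ (pd ν f) x = fderiv ℝ (fderiv ℝ f) x (Pi.single μ 1) (Pi.single ν 1) := by
  unfold pd
  rw [fderiv_clm_apply (differentiable_fderiv_of_smooth hf x) (differentiableAt_const _)]
  simp

theorem pd_comm {f : Spacetime → ℝ} (hf : ContDiff ℝ (⊤ : ℕ∞) f) (μ ν : Fin 4)
    (x : Spacetime) : pd μ (pd ν f) x = pd ν (pd μ f) x := by
  rw [pd_pd hf, pd_pd hf]
  exact hf.contDiffAt.isSymmSndFDerivAt
    (by simpa using WithTop.coe_le_coe.2 (le_top : (2 : ℕ∞) ≤ ⊤)) _ _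

theorem pd_christoffel {f : Spacetime → ℝ} (hf : ContDiff ℝ (⊤ : ℕ∞) f)
    (h0 : ∀ x, pd 0 f x = 0) (x : Spacetime) (κ l μ ν : Fin 4) :
    pd κ (fun y => christoffel f y l μ ν) x =
      (1/2 * lUp l * lCov ν) * pd κ (pd μ f) x + (1/2 * lUp l * lCov μ) * pd κ (pd ν f) x
        - (1/2 * lUp l * lCov μ * lCov ν) * pd κ (pd 3 f) x
        + (1/2 * (if l = 1 then 1 else 0) * lCov μ * lCov ν) * pd κ (pd 1 f) x
        + (1/2 * (if l = 2 then 1 else 0) * lCov μ * lCov ν) * pd κ (pd 2 f) x := by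
  simp only [christoffel_eq h0]
  have h := fun i (c : ℝ) => ((differentiable_pd hf i x).hasFDerivAt).const_mul c
  exact congrArg (fun L : Spacetime →L[ℝ] ℝ => L (Pi.single κ 1))
    (((((h μ _).add (h ν _)).sub (h 3 _)).add (h 1 _)).add (h 2 _)).fderiv

/-- {Ric}_{λν} = ½ (∂₁²f + ∂₂²f) l_λ l_ν. -/
theorem pp_wave_ricci_formula
    (f : Spacetime → ℝ) (hf : ContDiff ℝ (⊤ : ℕ∞) f) (h0 : ∀ x, pd 0 f x = 0) :
    ∀ (x : Spacetime) (lam ν : Fin 4),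
      RicLC f x lam ν =
        (1/2) * (pd 1 (pd 1 f) x + pd 2 (pd 2 f) x) * lCov lam * lCov ν := by
  intro x lam ν
  have h00 (μ : Fin 4) : pd μ (pd 0 f) x = 0 := by
    rw [funext h0]
    simp [pd]
  have h0' (μ : Fin 4) : pd 0 (pd μ f) x = 0 := by rw [pd_comm hf, h00]
  simp only [RicLC, curv, pd_christoffel hf h0, Fin.sum_univ_four]
  simp only [christoffel_eq h0]
  fin_cases lam <;> fin_cases ν <;> simp [lCov, lUp, h0, h00, h0'] <;> ring
end
end

section
/- The right Hodge dual of the torsion-generated curvature of a generalised pp-wave with purely axial torsion satisfies, for all κ, λ, μ, ν: ½ (R_T)_{κλαβ} g^{αρ} g^{βσ} ε_{ρσμν} = ¼ k(x³)² Im( F_{κλ} F̄_{μν} ) + ½ k′(x³) Re( F_{κλ} F̄_{μν} ), where (R_T)_{κλμν} = g_{κρ} R[K]^ρ_{λμν}. -/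
noncomputable section

open scoped BigOperators

/-- The complex vector m_μ = (0,−1,i,0). -/
def mCov : Fin 4 → ℂ := ![0, -1, Complex.I, 0]

/-- l_μ regarded as a complex vector. -/
def lCovC : Fin 4 → ℂ := fun μ => if μ = 3 then 1 else 0

/-- The bivector F_{κλ} = (l ∧ m)_{κλ} = l_κ m_λ − m_κ l_λ. -/
def Fbiv (κ l : Fin 4) : ℂ := lCovC κ * mCov l - mCov κ * lCovC l

theorem pd_comp_coord_three {k : ℝ → ℝ} (hk : Differentiable ℝ k) (c : ℝ) (μ : Fin 4)
    (x : Spacetime) :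
    pd μ (fun y => k (y 3) * c) x = if μ = 3 then deriv k (x 3) * c else 0 := by
  have hproj : HasFDerivAt (fun y : Spacetime => y 3)
      (ContinuousLinearMap.proj (R := ℝ) (φ := fun _ : Fin 4 => ℝ) 3) x :=
    (ContinuousLinearMap.proj (R := ℝ) (φ := fun _ : Fin 4 => ℝ) 3).hasFDerivAt
  have h := (((hk (x 3)).hasDerivAt.comp_hasFDerivAt x hproj).mul_const c).fderiv
  simp only [Function.comp_def] at h
  rw [pd, h]
  by_cases hμ : μ = 3 <;> simp [hμ, eq_comm, mul_comm]

/-- The contorsion of `torsion 1`; it does not depend on the profile `f` of the metric. -/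
def unitContorsion : Fin 4 → Fin 4 → Fin 4 → ℝ :=
  ![![![0, 0, 0, 0], ![0, 0, 1/2, 0], ![0, -1/2, 0, 0], ![0, 0, 0, 0]],
    ![![0, 0, 0, 0], ![0, 0, 0, 0], ![0, 0, 0, -1/2], ![0, 0, 1/2, 0]],
    ![![0, 0, 0, 0], ![0, 0, 0, 1/2], ![0, 0, 0, 0], ![0, -1/2, 0, 0]],
    0]

theorem contorsion_eq (f : Spacetime → ℝ) (k : ℝ → ℝ) (x : Spacetime) (κ μ ν : Fin 4) :
    contorsion f k x κ μ ν = k (x 3) * unitContorsion κ μ ν := by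
  fin_cases κ <;> fin_cases μ <;> fin_cases ν <;>
    simp [contorsion, torsion, ppMetricInv, Fin.sum_univ_four, unitContorsion, eps] <;> ring

theorem curv_contorsion (f : Spacetime → ℝ) {k : ℝ → ℝ} (hk : Differentiable ℝ k)
    (x : Spacetime) (κ l μ ν : Fin 4) :
    curv (contorsion f k) x κ l μ ν =
      deriv k (x 3) * ((if μ = 3 then unitContorsion κ ν l else 0)
        - (if ν = 3 then unitContorsion κ μ l else 0))
      + (k (x 3))^2 * ∑ η, (unitContorsion κ μ η * unitContorsion η ν l
        - unitContorsion κ ν η * unitContorsion η μ l) := by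
  simp only [curv, contorsion_eq, pd_comp_coord_three hk, Finset.mul_sum]
  congr 1
  · split_ifs <;> ring
  · exact Finset.sum_congr rfl fun η _ => by ring

set_option maxHeartbeats 4000000 in
theorem lowered_curv_contorsion (f : Spacetime → ℝ) {k : ℝ → ℝ} (hk : Differentiable ℝ k)
    (x : Spacetime) (κ l μ ν : Fin 4) :
    ∑ τ, ppMetric f x κ τ * curv (contorsion f k) x τ l μ ν =
      (1/4) * (k (x 3))^2 * (Fbiv κ l * (starRingEnd ℂ) (Fbiv μ ν)).re
        - (1/2) * deriv k (x 3) * (Fbiv κ l * (starRingEnd ℂ) (Fbiv μ ν)).im := by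
  simp only [curv_contorsion f hk, Fin.sum_univ_four]
  generalize deriv k (x 3) = a
  generalize k (x 3) = b
  fin_cases κ <;> fin_cases l <;> fin_cases μ <;> fin_cases ν <;>
    simp [ppMetric, unitContorsion, Fbiv, lCovC, mCov] <;> ring

/-- Twice the Hodge dual of `F̄` is `-2i F̄`. -/
theorem hodge_conj_Fbiv (f : Spacetime → ℝ) (x : Spacetime) (μ ν : Fin 4) :
    ∑ α, ∑ β, ∑ ρ, ∑ σ, (starRingEnd ℂ) (Fbiv α β) *
        ((ppMetricInv f x α ρ * ppMetricInv f x β σ * eps ρ σ μ ν : ℝ) : ℂ) =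
      -2 * Complex.I * (starRingEnd ℂ) (Fbiv μ ν) := by
  fin_cases μ <;> fin_cases ν <;>
    simp [Fin.sum_univ_four, ppMetricInv, eps, Fbiv, lCovC, mCov] <;>
    ring_nf <;> simp

/-- the right Hodge dual of the torsion-generated curvature equals
¼ k² Im(F_{κλ} F̄_{μν}) + ½ k′ Re(F_{κλ} F̄_{μν}). -/
theorem torsion_curvature_right_hodge_dual
    (f : Spacetime → ℝ) (hf : ContDiff ℝ (⊤ : ℕ∞) f) (h0 : ∀ x, pd 0 f x = 0)
    (k : ℝ → ℝ) (hk : ContDiff ℝ (⊤ : ℕ∞) k) :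
    ∀ (x : Spacetime) (κ lam μ ν : Fin 4),
      (1/2) * ∑ α, ∑ β, ∑ ρ, ∑ σ,
        (∑ τ, ppMetric f x κ τ * curv (contorsion f k) x τ lam α β) *
          ppMetricInv f x α ρ * ppMetricInv f x β σ * eps ρ σ μ ν =
        (1/4) * (k (x 3))^2 * (Fbiv κ lam * (starRingEnd ℂ) (Fbiv μ ν)).im
          + (1/2) * deriv k (x 3) * (Fbiv κ lam * (starRingEnd ℂ) (Fbiv μ ν)).re := by
  intro x κ lam μ ν
  have hodge := congrArg (fun z => Fbiv κ lam * z) (hodge_conj_Fbiv f x μ ν)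
  simp only [Finset.mul_sum, ← mul_assoc (Fbiv κ lam)] at hodge
  have hre := congrArg Complex.re hodge
  have him := congrArg Complex.im hodge
  simp only [Complex.re_sum, Complex.im_sum, Complex.re_mul_ofReal, Complex.im_mul_ofReal]
    at hre him
  have hrot : Fbiv κ lam * -2 * Complex.I * (starRingEnd ℂ) (Fbiv μ ν) =
      ((-2 : ℝ) : ℂ) * (Complex.I * (Fbiv κ lam * (starRingEnd ℂ) (Fbiv μ ν))) := by
    push_cast
    ring
  rw [hrot, Complex.re_ofReal_mul, Complex.I_mul_re] at hre
  rw [hrot, Complex.im_ofReal_mul, Complex.I_mul_im] at him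
  simp only [lowered_curv_contorsion f (hk.differentiable (by simp)),
    sub_mul, Finset.sum_sub_distrib]
  simp only [mul_assoc, ← Finset.mul_sum] at hre him ⊢
  rw [hre, him]
  ring
end
end
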